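/- Let n ≥ 3 be an odd integer and let P_n be the prism graph of order 2n, i.e. the box product of the cycle graph C_n with K_2. If there exists p : ZMod n → ℂ with 1 ≤ ‖p j‖ ≤ λ and 1 ≤ ‖p j - p (j-1)‖ ≤ λ for all j (i.e. the wheel W_n admits a complex nowhere-zero (λ+1)-flow), then P_n admits a complex nowhere-zero (λ+1)-flow. -/

import Mathlib

open Real SimpleGraph

/-- A complex nowhere-zero `r`-flow on a finite simple graph `G`. -/
def HasComplexNZFlow {V : Type*} [Fintype V] [DecidableEq V]
    (G : SimpleGraph V) [DecidableRel G.Adj] (r : ℝ) : Prop :=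
  ∃ f : G.Dart → ℂ,
    (∀ d : G.Dart, f d.symm = -f d) ∧
    (∀ v : V, ∑ d ∈ Finset.univ.filter (fun d : G.Dart => d.fst = v), f d = 0) ∧
    (∀ d : G.Dart, 1 ≤ ‖f d‖ ∧ ‖f d‖ ≤ r - 1)

/-- A function on ordered pairs of vertices that vanishes off the edges of `G`, summed over the
darts leaving `v`, is summed over all vertices. -/
theorem sum_darts_fst_eq {V : Type*} [Fintype V] [DecidableEq V] (G : SimpleGraph V)
    [DecidableRel G.Adj] (F : V → V → ℂ) (hF : ∀ v w, ¬ G.Adj v w → F v w = 0) (v : V) :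
    ∑ d ∈ Finset.univ.filter (fun d : G.Dart => d.fst = v), F d.fst d.snd = ∑ w, F v w := by
  have h : ∑ w, F v w = ∑ w ∈ Finset.univ.filter (G.Adj v), F v w := by
    rw [Finset.sum_filter]
    exact Finset.sum_congr rfl fun w _ => by
      split_ifs with hw
      · rfl
      · exact hF v w hw
  rw [h]
  refine Finset.sum_bij (fun d _ => d.snd) ?_ ?_ ?_ ?_
  · intro d hd
    obtain rfl : d.fst = v := by simpa using hd
    simp
  · intro d hd e he hde
    have hd' : d.fst = v := by simpa using hd
    have he' : e.fst = v := by simpa using he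
    exact SimpleGraph.Dart.ext _ _ (Prod.ext (hd'.trans he'.symm) hde)
  · intro w hw
    exact ⟨⟨(v, w), by simpa using hw⟩, by simp, rfl⟩
  · intro d hd
    have hd' : d.fst = v := by simpa using hd
    rw [hd']

/-- A flow given by an antisymmetric function on ordered pairs of vertices. -/
theorem hasComplexNZFlow_of_pairs {V : Type*} [Fintype V] [DecidableEq V] (G : SimpleGraph V)
    [DecidableRel G.Adj] (r : ℝ) (F : V → V → ℂ) (hF : ∀ v w, ¬ G.Adj v w → F v w = 0)
    (hanti : ∀ v w, F w v = -F v w) (hsum : ∀ v, ∑ w, F v w = 0)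
    (hnorm : ∀ v w, G.Adj v w → 1 ≤ ‖F v w‖ ∧ ‖F v w‖ ≤ r - 1) :
    HasComplexNZFlow G r :=
  ⟨fun d => F d.fst d.snd, fun d => hanti d.fst d.snd,
    fun v => (sum_darts_fst_eq G F hF v).trans (hsum v), fun d => hnorm _ _ d.adj⟩

/-- The flow on the prism carrying `p` around one copy of the cycle, `-p` around the other, and the
differences of `p` along the rungs. -/
noncomputable def prismFlow {m : ℕ} (p : Fin (m + 3) → ℂ) (v w : Fin (m + 3) × Fin 2) : ℂ :=
  (if v.2 = 0 then 1 else -1) *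
    if v.2 = w.2 then (if w.1 = v.1 + 1 then p v.1 else 0) - (if v.1 = w.1 + 1 then p w.1 else 0)
    else if v.1 = w.1 then p (v.1 - 1) - p v.1 else 0

theorem Fin.ne_add_one_add_one {m : ℕ} (i : Fin (m + 3)) : i ≠ i + 1 + 1 := by
  rw [add_assoc]
  intro h
  have h2 := congrArg Fin.val (left_eq_add.mp h)
  simp [Fin.val_add, Nat.mod_eq_of_lt] at h2

theorem prismFlow_swap {m : ℕ} (p : Fin (m + 3) → ℂ) (v w : Fin (m + 3) × Fin 2) :
    prismFlow p w v = -prismFlow p v w := by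
  obtain ⟨i, a⟩ := v
  obtain ⟨j, b⟩ := w
  rcases eq_or_ne i j with rfl | hij
  · fin_cases a <;> fin_cases b <;> simp [prismFlow]
  · fin_cases a <;> fin_cases b <;> simp [prismFlow, hij, hij.symm]

theorem sum_prismFlow {m : ℕ} (p : Fin (m + 3) → ℂ) (v : Fin (m + 3) × Fin 2) :
    ∑ w, prismFlow p v w = 0 := by
  obtain ⟨i, a⟩ := v
  have h (j : Fin (m + 3)) : i = j + 1 ↔ j = i - 1 := by
    rw [eq_comm, eq_sub_iff_add_eq]
  rw [Fintype.sum_prod_type_right, Fin.sum_univ_two]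
  fin_cases a <;> simp [prismFlow, h]

theorem cycleGraph_adj_iff {m : ℕ} (i j : Fin (m + 3)) :
    (cycleGraph (m + 3)).Adj i j ↔ j = i + 1 ∨ i = j + 1 := by
  rw [cycleGraph_adj, sub_eq_iff_eq_add', sub_eq_iff_eq_add', or_comm]

open scoped Classical in
theorem wheel_flow_extends_to_prism (n : ℕ) (hn : 3 ≤ n) (hodd : Odd n) (l : ℝ)
    (hp : ∃ p : ZMod n → ℂ, ∀ j : ZMod n,
      1 ≤ ‖p j‖ ∧ ‖p j‖ ≤ l ∧ 1 ≤ ‖p j - p (j - 1)‖ ∧ ‖p j - p (j - 1)‖ ≤ l) :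
    HasComplexNZFlow ((cycleGraph n).boxProd (completeGraph (Fin 2))) (l + 1) := by
  obtain ⟨m, rfl⟩ : ∃ m, n = m + 3 := ⟨n - 3, by omega⟩
  obtain ⟨p, hp⟩ := hp
  change Fin (m + 3) → ℂ at p
  replace hp : ∀ j : Fin (m + 3),
      1 ≤ ‖p j‖ ∧ ‖p j‖ ≤ l ∧ 1 ≤ ‖p j - p (j - 1)‖ ∧ ‖p j - p (j - 1)‖ ≤ l := hp
  have hsign (a : Fin 2) : ‖(if a = 0 then 1 else -1 : ℂ)‖ = 1 := by split_ifs <;> simp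
  refine hasComplexNZFlow_of_pairs _ _ (prismFlow p) ?_ (prismFlow_swap p) (sum_prismFlow p) ?_
  · rintro ⟨i, a⟩ ⟨j, b⟩ h
    simp only [boxProd_adj, cycleGraph_adj_iff, top_adj] at h
    push Not at h
    unfold prismFlow
    rcases eq_or_ne a b with rfl | hab
    · have h1 : ¬ j = i + 1 := fun e => h.1 (Or.inl e) rfl
      have h2 : ¬ i = j + 1 := fun e => h.1 (Or.inr e) rfl
      simp [h1, h2]
    · simp [hab, h.2 hab]
  · rintro ⟨i, a⟩ ⟨j, b⟩ h
    simp only [boxProd_adj, cycleGraph_adj_iff, top_adj] at h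
    rw [add_sub_cancel_right, prismFlow, norm_mul, hsign, one_mul]
    rcases h with ⟨rfl | rfl, rfl⟩ | ⟨hab, rfl⟩
    · simpa [Fin.ne_add_one_add_one] using ⟨(hp i).1, (hp i).2.1⟩
    · simpa [Fin.ne_add_one_add_one] using ⟨(hp j).1, (hp j).2.1⟩
    · simpa [hab, norm_sub_rev] using (hp i).2.2
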